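/- As n → ∞, 𝔼(y_{n+1}^3 Π̂(n)) = O(n/M_n^4). -/

import Mathlib

open MeasureTheory Filter Finset Asymptotics
open scoped Classical

/-- `y_m(α) = ∏_{j ∈ α, j < m} (1 - 1/j)` (empty product = 1). -/
noncomputable def hawkinsY (A : Set ℕ) (m : ℕ) : ℝ :=
  ∏ j ∈ Finset.range m, if j ∈ A then 1 - 1 / (j : ℝ) else 1

/-- The σ-algebra generated by the events `{j ∈ α}` for `2 ≤ j < m`. -/
def sieveSigma {Ω : Type*} (α : Ω → Set ℕ) (m : ℕ) : MeasurableSpace Ω :=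
  MeasurableSpace.generateFrom {s | ∃ j : ℕ, 2 ≤ j ∧ j < m ∧ s = {ω | j ∈ α ω}}

/-- Wunderlich's model of the Hawkins random sieve: a probability space `(Ω, μ)` with a
random subset `α` of `{2,3,4,…}` such that `μ(2 ∈ α) = 1` and, for every `m ≥ 2`, the
conditional probability of `{m ∈ α}` given the σ-algebra generated by the events
`{j ∈ α}`, `2 ≤ j < m`, equals `y_m(α)`. -/
structure IsHawkinsSieve {Ω : Type*} [MeasurableSpace Ω] (μ : Measure Ω)
    (α : Ω → Set ℕ) : Prop where
  isProb : IsProbabilityMeasure μ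
  meas : ∀ n : ℕ, MeasurableSet {ω | n ∈ α ω}
  mem_ge_two : ∀ ω, ∀ n ∈ α ω, 2 ≤ n
  two_mem : μ {ω | 2 ∈ α ω} = 1
  condExp_mem : ∀ m : ℕ, 2 ≤ m →
    μ[Set.indicator {ω | m ∈ α ω} (fun _ => (1 : ℝ)) | sieveSigma α m]
      =ᵐ[μ] fun ω => hawkinsY (α ω) m

/-- `M_k = 1 + ∑_{j=1}^{k-2} 1/j` (so `M_2 = 1`). -/
noncomputable def Mharm (k : ℕ) : ℝ := 1 + ∑ j ∈ Finset.Icc 1 (k - 2), 1 / (j : ℝ)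

/-- `Π̂(x; α) = Σ_{m ≤ x, m ∈ α, m+2 ∈ α} (y_m(α) - (1/(m+1))(1 - 1/m) y_m(α)^2)⁻¹`. -/
noncomputable def piHat (A : Set ℕ) (x : ℕ) : ℝ :=
  ∑ m ∈ Finset.range (x + 1),
    if m ∈ A ∧ m + 2 ∈ A then
      (hawkinsY A m - (1 / ((m : ℝ) + 1)) * (1 - 1 / (m : ℝ)) * (hawkinsY A m) ^ 2)⁻¹
    else 0

lemma hawkinsY_succ (A : Set ℕ) (m : ℕ) :
    hawkinsY A (m + 1) = hawkinsY A m * (if m ∈ A then 1 - 1 / (m : ℝ) else 1) := by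
  simp only [hawkinsY, Finset.prod_range_succ]

lemma hawkinsY_factor_mem_Ioc {A : Set ℕ} (hA : ∀ n ∈ A, 2 ≤ n) (m : ℕ) :
    (if m ∈ A then 1 - 1 / (m : ℝ) else 1) ∈ Set.Ioc (0 : ℝ) 1 := by
  split_ifs with hm
  · have h2 : (2 : ℝ) ≤ m := by exact_mod_cast hA m hm
    have h3 : 1 / (m : ℝ) ≤ 1 / 2 := one_div_le_one_div_of_le two_pos h2
    have h4 : 0 ≤ 1 / (m : ℝ) := by positivity
    constructor <;> linarith
  · simp

lemma hawkinsY_mem_Ioc {A : Set ℕ} (hA : ∀ n ∈ A, 2 ≤ n) (m : ℕ) :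
    hawkinsY A m ∈ Set.Ioc (0 : ℝ) 1 := by
  induction m with
  | zero => simp [hawkinsY]
  | succ m ih =>
    have hf := hawkinsY_factor_mem_Ioc hA m
    rw [hawkinsY_succ]
    exact ⟨mul_pos ih.1 hf.1, mul_le_one₀ ih.2 hf.1.le hf.2⟩

lemma hawkinsY_antitone {A : Set ℕ} (hA : ∀ n ∈ A, 2 ≤ n) : Antitone (hawkinsY A) := by
  refine antitone_nat_of_succ_le fun m => ?_
  rw [hawkinsY_succ]
  exact mul_le_of_le_one_right (hawkinsY_mem_Ioc hA m).1.le (hawkinsY_factor_mem_Ioc hA m).2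

lemma Mharm_succ (k : ℕ) : Mharm (k + 3) = Mharm (k + 2) + 1 / ((k : ℝ) + 1) := by
  have h : k + 3 - 2 = k + 1 := by omega
  simp only [Mharm, h, Nat.add_sub_cancel, Finset.sum_Icc_succ_top (Nat.le_add_left 1 k)]
  push_cast
  ring

lemma Mharm_two : Mharm 2 = 1 := by simp [Mharm]

lemma one_le_Mharm (k : ℕ) : 1 ≤ Mharm k := by
  unfold Mharm
  have : 0 ≤ ∑ j ∈ Finset.Icc 1 (k - 2), 1 / (j : ℝ) := by positivity
  linarith

lemma Mharm_le (k : ℕ) : Mharm (k + 2) ≤ k + 1 := by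
  induction k with
  | zero => simp [Mharm_two]
  | succ k ih =>
    have : 1 / ((k : ℝ) + 1) ≤ 1 := by
      rw [div_le_one (by positivity)]; linarith [(Nat.cast_nonneg k : (0 : ℝ) ≤ k)]
    rw [Mharm_succ]; push_cast; linarith

lemma Mharm_monotone : Monotone fun k => Mharm (k + 2) := by
  refine monotone_nat_of_le_succ fun k => ?_
  have : 0 ≤ 1 / ((k : ℝ) + 1) := by positivity
  have := Mharm_succ k
  simp only [show k + 1 + 2 = k + 3 from rfl]
  linarith

lemma exists_le_Mharm (C : ℝ) : ∃ k, C ≤ Mharm (k + 2) := by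
  obtain ⟨k, hk⟩ := (Real.tendsto_sum_range_one_div_nat_succ_atTop.eventually_ge_atTop C).exists
  refine ⟨k, hk.trans ?_⟩
  clear hk
  induction k with
  | zero => simp [Mharm_two]
  | succ k ih =>
    rw [Finset.sum_range_succ, Mharm_succ]
    linarith

lemma one_sub_div_div_pow_four_le {M δ : ℝ} (hM : 0 < M) (hδ : 0 ≤ δ) :
    (1 - 4 * δ / M) / M ^ 4 ≤ 1 / (M + δ) ^ 4 := by
  have h1 : (1 - 4 * δ / M) / M ^ 4 = (M - 4 * δ) / M ^ 5 := by field_simp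
  rw [h1, div_le_div_iff₀ (by positivity) (by positivity)]
  have : 0 ≤ 10 * (M ^ 3 * δ ^ 2) + 20 * (M ^ 2 * δ ^ 3) + 15 * (M * δ ^ 4) + 4 * δ ^ 5 := by
    positivity
  nlinarith [this]

lemma pow_five_ge_tangent {y t : ℝ} (hy : 0 ≤ y) (ht : 0 ≤ t) :
    5 / 4 * t * y ^ 4 - t ^ 5 / 4 ≤ y ^ 5 := by
  have h : y ^ 5 - (5 / 4 * t * y ^ 4 - t ^ 5 / 4) =
      (y - t) ^ 2 * (4 * y ^ 3 + 3 * y ^ 2 * t + 2 * y * t ^ 2 + t ^ 3) / 4 := by ring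
  have : 0 ≤ (y - t) ^ 2 * (4 * y ^ 3 + 3 * y ^ 2 * t + 2 * y * t ^ 2 + t ^ 3) / 4 := by
    positivity
  linarith

lemma exists_sum_one_div_Mharm_pow_le :
    ∃ C : ℝ, ∃ N : ℕ, ∀ k, N ≤ k →
      ∑ j ∈ Finset.range (k + 1), 1 / Mharm (j + 2) ^ 4 ≤
        C * (((k + 2 : ℕ) : ℝ) / Mharm (k + 2) ^ 4) := by
  obtain ⟨N, hN⟩ := exists_le_Mharm 24
  have hf : ∀ k : ℕ, 0 < ((k + 2 : ℕ) : ℝ) / Mharm (k + 2) ^ 4 := fun k => by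
    have := one_le_Mharm (k + 2)
    positivity
  set S := ∑ j ∈ Finset.range (N + 1), 1 / Mharm (j + 2) ^ 4
  refine ⟨max 8 (S / (((N + 2 : ℕ) : ℝ) / Mharm (N + 2) ^ 4)), N, fun k hk => ?_⟩
  set C := max 8 (S / (((N + 2 : ℕ) : ℝ) / Mharm (N + 2) ^ 4)) with hC
  have hC8 : 8 ≤ C := le_max_left _ _
  induction k, hk using Nat.le_induction with
  | base => exact (div_le_iff₀ (hf N)).1 (le_max_right _ _)
  | succ k hk ih =>
    rw [Finset.sum_range_succ]
    have hM : 24 ≤ Mharm (k + 2) := hN.trans (Mharm_monotone hk)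
    have hM0 : 0 < Mharm (k + 2) := by linarith
    have hδ : 0 ≤ 1 / ((k : ℝ) + 1) := by positivity
    have hδ1 : (k + 3 : ℝ) * (1 / ((k : ℝ) + 1)) ≤ 3 := by
      rw [mul_one_div, div_le_iff₀ (by positivity)]; linarith [(Nat.cast_nonneg k : (0 : ℝ) ≤ k)]
    have key := one_sub_div_div_pow_four_le hM0 hδ
    have hle : 1 / Mharm (k + 3) ^ 4 ≤ 1 / Mharm (k + 2) ^ 4 := by
      have : Mharm (k + 2) ≤ Mharm (k + 3) := Mharm_monotone (Nat.le_succ k)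
      gcongr
    rw [← Mharm_succ] at key
    set M := Mharm (k + 2)
    set M' := Mharm (k + 3)
    set δ := 1 / ((k : ℝ) + 1)
    have hq : (k + 3) * (4 * δ / M) ≤ 1 / 2 := by
      rw [← mul_div_assoc, div_le_iff₀ hM0]; nlinarith
    have hstep : (k + 2 + 1 / 2 : ℝ) * (1 / M ^ 4) ≤ (k + 3) * (1 / M' ^ 4) := by
      calc (k + 2 + 1 / 2 : ℝ) * (1 / M ^ 4)
          ≤ (k + 3) * (1 - 4 * δ / M) * (1 / M ^ 4) := by gcongr; linarith
        _ = (k + 3) * ((1 - 4 * δ / M) / M ^ 4) := by ring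
        _ ≤ _ := by gcongr
    have hp : 0 ≤ 1 / M ^ 4 := by positivity
    have e1 : C * (((k + 2 : ℕ) : ℝ) / M ^ 4) = C * ((k + 2) * (1 / M ^ 4)) := by
      push_cast; ring
    have e2 : C * (((k + 1 + 2 : ℕ) : ℝ) / M' ^ 4) = C * ((k + 3) * (1 / M' ^ 4)) := by
      push_cast; ring
    change _ + 1 / M' ^ 4 ≤ C * (((k + 1 + 2 : ℕ) : ℝ) / M' ^ 4)
    rw [e2]
    rw [e1] at ih
    have h5 := mul_le_mul_of_nonneg_left hstep (by linarith : 0 ≤ C)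
    nlinarith [mul_le_mul_of_nonneg_right hC8 hp]

lemma mem_indicator_mem_Icc {Ω : Type*} {α : Ω → Set ℕ} (j : ℕ) (ω : Ω) :
    ({ω | j ∈ α ω}.indicator fun _ => (1 : ℝ)) ω ∈ Set.Icc (0 : ℝ) 1 := by
  by_cases hj : j ∈ α ω <;> simp [hj]

namespace IsHawkinsSieve

variable {Ω : Type*} [mΩ : MeasurableSpace Ω] {μ : Measure Ω} {α : Ω → Set ℕ}

lemma sieveSigma_le (h : IsHawkinsSieve μ α) (m : ℕ) : sieveSigma α m ≤ mΩ := by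
  refine MeasurableSpace.generateFrom_le ?_
  rintro s ⟨j, -, -, rfl⟩
  exact h.meas j

lemma measurableSet_sieveSigma (h : IsHawkinsSieve μ α) {j m : ℕ} (hj : j < m) :
    MeasurableSet[sieveSigma α m] {ω | j ∈ α ω} := by
  by_cases h2 : 2 ≤ j
  · exact MeasurableSpace.measurableSet_generateFrom ⟨j, h2, hj, rfl⟩
  · have : {ω | j ∈ α ω} = ∅ := by
      ext ω
      simpa using fun hω => h2 (h.mem_ge_two ω j hω)
    rw [this]
    exact @MeasurableSet.empty _ (sieveSigma α m)

lemma measurable_hawkinsY (h : IsHawkinsSieve μ α) {j m : ℕ} (hj : j ≤ m) :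
    Measurable[sieveSigma α m] fun ω => hawkinsY (α ω) j := by
  unfold hawkinsY
  refine Finset.measurable_fun_prod _ fun i hi => ?_
  have hi' : i < m := (Finset.mem_range.1 hi).trans_le hj
  exact Measurable.ite (h.measurableSet_sieveSigma hi') measurable_const measurable_const

lemma measurable_mem_indicator (h : IsHawkinsSieve μ α) {j m : ℕ} (hj : j < m) :
    Measurable[sieveSigma α m] ({ω | j ∈ α ω}.indicator fun _ => (1 : ℝ)) :=
  measurable_const.indicator (h.measurableSet_sieveSigma hj)

lemma integrable_of_bound (h : IsHawkinsSieve μ α) {m : ℕ} {f : Ω → ℝ}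
    (hf : Measurable[sieveSigma α m] f) (hb : ∀ ω, f ω ∈ Set.Icc (0 : ℝ) 1) :
    Integrable f μ := by
  have := h.isProb
  refine Integrable.of_bound (hf.mono (h.sieveSigma_le m) le_rfl).aestronglyMeasurable 1 ?_
  exact ae_of_all _ fun ω => by
    rw [Real.norm_of_nonneg (hb ω).1]; exact (hb ω).2

lemma integrable_hawkinsY_pow (h : IsHawkinsSieve μ α) (m k : ℕ) :
    Integrable (fun ω => hawkinsY (α ω) m ^ k) μ :=
  h.integrable_of_bound ((h.measurable_hawkinsY le_rfl).pow_const k) fun ω => by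
    have := hawkinsY_mem_Ioc (h.mem_ge_two ω) m
    exact ⟨pow_nonneg this.1.le _, pow_le_one₀ this.1.le this.2⟩

lemma integral_mul_mem_indicator (h : IsHawkinsSieve μ α) {m : ℕ} (hm : 2 ≤ m) {f : Ω → ℝ}
    (hf : Measurable[sieveSigma α m] f) (hb : ∀ ω, f ω ∈ Set.Icc (0 : ℝ) 1) :
    ∫ ω, f ω * ({ω | m ∈ α ω}.indicator fun _ => (1 : ℝ)) ω ∂μ =
      ∫ ω, f ω * hawkinsY (α ω) m ∂μ := by
  have := h.isProb
  have hI : Integrable ({ω | m ∈ α ω}.indicator fun _ => (1 : ℝ)) μ :=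
    h.integrable_of_bound (h.measurable_mem_indicator (Nat.lt_succ_self m))
      (mem_indicator_mem_Icc m)
  have hfI : Integrable (f * {ω | m ∈ α ω}.indicator fun _ => (1 : ℝ)) μ := by
    refine h.integrable_of_bound (m := m + 1)
      (((hf.mono ?_ le_rfl)).mul (h.measurable_mem_indicator (Nat.lt_succ_self m))) fun ω => ?_
    · refine MeasurableSpace.generateFrom_mono ?_
      rintro s ⟨j, h2, hj, rfl⟩
      exact ⟨j, h2, hj.trans (Nat.lt_succ_self m), rfl⟩
    · have h1 := hb ω
      have h2 := mem_indicator_mem_Icc (α := α) m ω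
      exact ⟨mul_nonneg h1.1 h2.1, mul_le_one₀ h1.2 h2.1 h2.2⟩
  have hc := condExp_mul_of_stronglyMeasurable_left hf.stronglyMeasurable hfI hI
  calc ∫ ω, f ω * ({ω | m ∈ α ω}.indicator fun _ => (1 : ℝ)) ω ∂μ
      = ∫ ω, (μ[f * {ω | m ∈ α ω}.indicator fun _ => (1 : ℝ) | sieveSigma α m]) ω ∂μ :=
        (integral_condExp (h.sieveSigma_le m)).symm
    _ = ∫ ω, f ω * hawkinsY (α ω) m ∂μ := by
        refine integral_congr_ae ?_
        filter_upwards [hc, h.condExp_mem m hm] with ω h1 h2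
        rw [h1, Pi.mul_apply, h2]

lemma integral_hawkinsY_pow_four_succ (h : IsHawkinsSieve μ α) {m : ℕ} (hm : 2 ≤ m) :
    ∫ ω, hawkinsY (α ω) (m + 1) ^ 4 ∂μ =
      ∫ ω, hawkinsY (α ω) m ^ 4 ∂μ -
        (1 - (1 - 1 / (m : ℝ)) ^ 4) * ∫ ω, hawkinsY (α ω) m ^ 5 ∂μ := by
  have hmeas : Measurable[sieveSigma α m] fun ω => hawkinsY (α ω) m ^ 4 :=
    (h.measurable_hawkinsY le_rfl).pow_const 4
  have hb : ∀ ω, hawkinsY (α ω) m ^ 4 ∈ Set.Icc (0 : ℝ) 1 := fun ω => by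
    have := hawkinsY_mem_Ioc (h.mem_ge_two ω) m
    exact ⟨pow_nonneg this.1.le _, pow_le_one₀ this.1.le this.2⟩
  have hI := h.integral_mul_mem_indicator hm hmeas hb
  have hint : Integrable (fun ω => hawkinsY (α ω) m ^ 4 *
      ({ω | m ∈ α ω}.indicator fun _ => (1 : ℝ)) ω) μ := by
    refine (h.integrable_hawkinsY_pow m 4).mono' ?_ (ae_of_all _ fun ω => ?_)
    · exact ((hmeas.mono (h.sieveSigma_le m) le_rfl).mul
        ((h.measurable_mem_indicator (Nat.lt_succ_self m)).mono
          (h.sieveSigma_le (m + 1)) le_rfl)).aestronglyMeasurable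
    · have h2 := mem_indicator_mem_Icc (α := α) m ω
      rw [Real.norm_of_nonneg (mul_nonneg (hb ω).1 h2.1)]
      exact mul_le_of_le_one_right (hb ω).1 h2.2
  have hpt : ∀ ω, hawkinsY (α ω) (m + 1) ^ 4 = hawkinsY (α ω) m ^ 4 -
      (1 - (1 - 1 / (m : ℝ)) ^ 4) * (hawkinsY (α ω) m ^ 4 *
        ({ω | m ∈ α ω}.indicator fun _ => (1 : ℝ)) ω) := fun ω => by
    rw [hawkinsY_succ]
    by_cases hω : m ∈ α ω
    · simp only [hω, if_true, Set.indicator_of_mem (show ω ∈ {ω | m ∈ α ω} from hω)]; ring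
    · simp [hω]
  simp_rw [hpt]
  rw [integral_sub (h.integrable_hawkinsY_pow m 4) (hint.const_mul _), integral_const_mul, hI]
  simp_rw [← pow_succ]

lemma integral_hawkinsY_pow_four_le_one (h : IsHawkinsSieve μ α) (m : ℕ) :
    ∫ ω, hawkinsY (α ω) m ^ 4 ∂μ ≤ 1 := by
  have := h.isProb
  have h1 := integral_mono (h.integrable_hawkinsY_pow m 4) (integrable_const (1 : ℝ)) fun ω => by
    have := hawkinsY_mem_Ioc (h.mem_ge_two ω) m
    exact pow_le_one₀ this.1.le this.2
  simpa using h1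

lemma integral_hawkinsY_pow_five_ge (h : IsHawkinsSieve μ α) (m : ℕ) {t : ℝ} (ht : 0 ≤ t) :
    5 / 4 * t * ∫ ω, hawkinsY (α ω) m ^ 4 ∂μ - t ^ 5 / 4 ≤ ∫ ω, hawkinsY (α ω) m ^ 5 ∂μ := by
  have := h.isProb
  have h1 := integral_mono
    (((h.integrable_hawkinsY_pow m 4).const_mul (5 / 4 * t)).sub (integrable_const (t ^ 5 / 4)))
    (h.integrable_hawkinsY_pow m 5)
    fun ω => pow_five_ge_tangent (hawkinsY_mem_Ioc (h.mem_ge_two ω) m).1.le ht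
  simp only [Pi.sub_apply] at h1
  rw [integral_sub ((h.integrable_hawkinsY_pow m 4).const_mul (5 / 4 * t))
    (integrable_const (t ^ 5 / 4)), integral_const_mul] at h1
  simpa using h1

theorem integral_hawkinsY_pow_four_le (h : IsHawkinsSieve μ α) (k : ℕ) :
    ∫ ω, hawkinsY (α ω) (k + 2) ^ 4 ∂μ ≤ 4096 * (1 / Mharm (k + 2) ^ 4) := by
  induction k with
  | zero => rw [Mharm_two]; linarith [h.integral_hawkinsY_pow_four_le_one (0 + 2)]
  | succ k ih =>
    change ∫ ω, hawkinsY (α ω) (k + 3) ^ 4 ∂μ ≤ 4096 * (1 / Mharm (k + 3) ^ 4)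
    have hM1 := one_le_Mharm (k + 3)
    rcases le_or_gt (Mharm (k + 3)) 8 with h8 | h8
    · refine (h.integral_hawkinsY_pow_four_le_one _).trans ?_
      rw [mul_one_div, le_div_iff₀ (by positivity), one_mul]
      calc Mharm (k + 3) ^ 4 ≤ 8 ^ 4 := by gcongr
        _ = 4096 := by norm_num
    have hk0 : (0 : ℝ) ≤ k := Nat.cast_nonneg k
    have hδ0 : 0 ≤ 1 / ((k : ℝ) + 1) := by positivity
    have hδ1 : 1 / ((k : ℝ) + 1) ≤ 1 := by
      rw [div_le_one (by positivity)]; linarith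
    have hs := Mharm_succ k
    have hM7 : 7 < Mharm (k + 2) := by linarith
    have hM0 : 0 < Mharm (k + 2) := by linarith
    have hk := Mharm_le k
    have key := one_sub_div_div_pow_four_le hM0 hδ0
    rw [← hs] at key
    have hrec := h.integral_hawkinsY_pow_four_succ (m := k + 2) (by omega)
    have he := h.integral_hawkinsY_pow_five_ge (k + 2) (t := 8 / Mharm (k + 2)) (by positivity)
    push_cast at hrec
    set M := Mharm (k + 2)
    set a := ∫ ω, hawkinsY (α ω) (k + 2) ^ 4 ∂μ
    set e := ∫ ω, hawkinsY (α ω) (k + 2) ^ 5 ∂μ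
    set x := 1 / ((k : ℝ) + 2) with hx
    set d := 1 - (1 - x) ^ 4 with hd
    set t := 8 / M with ht
    have ht0 : 0 < t := by positivity
    have hx0 : 0 < x := by positivity
    have hx1 : x ≤ 1 / 8 := one_div_le_one_div_of_le (by norm_num) (by linarith)
    have hdx : x ≤ d := by
      have : (1 - x) ^ 4 ≤ (1 - x) ^ 1 :=
        pow_le_pow_of_le_one (by linarith) (by linarith) (by norm_num)
      linarith
    have hd4 : d ≤ 4 * x := by
      have := one_add_mul_le_pow (a := -x) (by linarith) 4
      rw [← sub_eq_add_neg] at this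
      push_cast at this
      linarith
    have ht87 : t ≤ 8 / 7 := by
      rw [ht]; gcongr
    have hdt : 5 / 4 * d * t ≤ 1 := by nlinarith
    have hat : a ≤ t ^ 4 := by
      refine ih.trans_eq ?_
      rw [ht]; ring
    have hd0 : 0 ≤ d := by linarith
    have hxδ : 1 / ((k : ℝ) + 1) ≤ 2 * x := by
      rw [hx, mul_one_div, div_le_div_iff₀ (by positivity) (by positivity)]; linarith
    rw [show k + 3 = k + 2 + 1 from rfl, hrec]
    calc a - d * e ≤ a - d * (5 / 4 * t * a - t ^ 5 / 4) := by gcongr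
      _ = a * (1 - 5 / 4 * d * t) + d * t ^ 5 / 4 := by ring
      _ ≤ t ^ 4 * (1 - 5 / 4 * d * t) + d * t ^ 5 / 4 := by
          have : 0 ≤ 1 - 5 / 4 * d * t := by linarith
          gcongr
      _ = 4096 * ((1 - 8 * d / M) / M ^ 4) := by rw [ht]; ring
      _ ≤ 4096 * ((1 - 4 * (1 / ((k : ℝ) + 1)) / M) / M ^ 4) := by
          gcongr 4096 * ((1 - ?_ / M) / M ^ 4)
          linarith
      _ ≤ _ := by gcongr

lemma integrable_sq_mul_indicators (h : IsHawkinsSieve μ α) (m : ℕ) :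
    Integrable (fun ω => hawkinsY (α ω) m ^ 2 *
      ({ω | m ∈ α ω}.indicator fun _ => (1 : ℝ)) ω *
      ({ω | m + 2 ∈ α ω}.indicator fun _ => (1 : ℝ)) ω) μ := by
  refine h.integrable_of_bound (m := m + 3)
    ((((h.measurable_hawkinsY (by omega)).pow_const 2).mul
      (h.measurable_mem_indicator (by omega))).mul (h.measurable_mem_indicator (by omega)))
    fun ω => ?_
  have h0 := hawkinsY_mem_Ioc (h.mem_ge_two ω) m
  have h1 := mem_indicator_mem_Icc (α := α) m ω
  have h2 := mem_indicator_mem_Icc (α := α) (m + 2) ω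
  have h3 := sq_nonneg (hawkinsY (α ω) m)
  exact ⟨mul_nonneg (mul_nonneg h3 h1.1) h2.1,
    mul_le_one₀ (mul_le_one₀ (pow_le_one₀ h0.1.le h0.2) h1.1 h1.2) h2.1 h2.2⟩

lemma integral_sq_mul_indicators_le (h : IsHawkinsSieve μ α) {m : ℕ} (hm : 2 ≤ m) :
    ∫ ω, hawkinsY (α ω) m ^ 2 * ({ω | m ∈ α ω}.indicator fun _ => (1 : ℝ)) ω *
      ({ω | m + 2 ∈ α ω}.indicator fun _ => (1 : ℝ)) ω ∂μ ≤
        ∫ ω, hawkinsY (α ω) m ^ 4 ∂μ := by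
  have hy := fun ω => hawkinsY_mem_Ioc (h.mem_ge_two ω) m
  have hI := mem_indicator_mem_Icc (α := α) m
  have hmeas : ∀ k, Measurable[sieveSigma α (m + 2)] fun ω => hawkinsY (α ω) m ^ k *
      ({ω | m ∈ α ω}.indicator fun _ => (1 : ℝ)) ω := fun k =>
    ((h.measurable_hawkinsY (by omega)).pow_const k).mul (h.measurable_mem_indicator (by omega))
  have hb : ∀ k ω, hawkinsY (α ω) m ^ k * ({ω | m ∈ α ω}.indicator fun _ => (1 : ℝ)) ω ∈
      Set.Icc (0 : ℝ) 1 := fun k ω =>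
    ⟨mul_nonneg (pow_nonneg (hy ω).1.le _) (hI ω).1,
      mul_le_one₀ (pow_le_one₀ (hy ω).1.le (hy ω).2) (hI ω).1 (hI ω).2⟩
  rw [h.integral_mul_mem_indicator (by omega) (hmeas 2) (hb 2)]
  have h3 := h.integral_mul_mem_indicator hm
    ((h.measurable_hawkinsY le_rfl).pow_const 3) fun ω =>
      ⟨pow_nonneg (hy ω).1.le _, pow_le_one₀ (hy ω).1.le (hy ω).2⟩
  simp_rw [← pow_succ] at h3
  rw [← h3]
  refine integral_mono_of_nonneg (ae_of_all _ fun ω => ?_)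
    (h.integrable_of_bound (hmeas 3) (hb 3)) (ae_of_all _ fun ω => ?_)
  · exact mul_nonneg (hb 2 ω).1 (hawkinsY_mem_Ioc (h.mem_ge_two ω) _).1.le
  · calc _ ≤ hawkinsY (α ω) m ^ 2 * ({ω | m ∈ α ω}.indicator fun _ => (1 : ℝ)) ω *
          hawkinsY (α ω) m :=
          mul_le_mul_of_nonneg_left
            (hawkinsY_antitone (h.mem_ge_two ω) (Nat.le_add_right m 2)) (hb 2 ω).1
      _ = _ := by ring

end IsHawkinsSieve

lemma hawkinsY_half_le_denominator {A : Set ℕ} (hA : ∀ n ∈ A, 2 ≤ n) {m : ℕ} (hm : 2 ≤ m) :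
    hawkinsY A m / 2 ≤
      hawkinsY A m - (1 / ((m : ℝ) + 1)) * (1 - 1 / (m : ℝ)) * (hawkinsY A m) ^ 2 := by
  obtain ⟨h0, h1⟩ := hawkinsY_mem_Ioc hA m
  have hm' : (2 : ℝ) ≤ m := by exact_mod_cast hm
  have hc : 1 / ((m : ℝ) + 1) ≤ 1 / 2 := one_div_le_one_div_of_le two_pos (by linarith)
  have hc0 : 0 ≤ 1 / ((m : ℝ) + 1) := by positivity
  have hd : 1 - 1 / (m : ℝ) ≤ 1 := by
    have : 0 ≤ 1 / (m : ℝ) := by positivity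
    linarith
  have hcd : 1 / ((m : ℝ) + 1) * (1 - 1 / (m : ℝ)) ≤ 1 / 2 :=
    (mul_le_of_le_one_right hc0 hd).trans hc
  have hsq : hawkinsY A m ^ 2 ≤ hawkinsY A m := by nlinarith
  have := mul_le_mul_of_nonneg_right hcd (sq_nonneg (hawkinsY A m))
  linarith

lemma piHat_nonneg {A : Set ℕ} (hA : ∀ n ∈ A, 2 ≤ n) (n : ℕ) : 0 ≤ piHat A n := by
  refine Finset.sum_nonneg fun m _ => ?_
  split_ifs with hm
  · have := hawkinsY_half_le_denominator hA (hA m hm.1)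
    have := (hawkinsY_mem_Ioc hA m).1
    exact inv_nonneg.2 (by linarith)
  · exact le_rfl

lemma pow_three_mul_piHat_le {Ω : Type*} {α : Ω → Set ℕ} {ω : Ω} (hA : ∀ n ∈ α ω, 2 ≤ n)
    (k : ℕ) :
    hawkinsY (α ω) (k + 3) ^ 3 * piHat (α ω) (k + 2) ≤
      ∑ j ∈ Finset.range (k + 1), 2 * (hawkinsY (α ω) (j + 2) ^ 2 *
        ({ω | j + 2 ∈ α ω}.indicator fun _ => (1 : ℝ)) ω *
        ({ω | j + 2 + 2 ∈ α ω}.indicator fun _ => (1 : ℝ)) ω) := by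
  have h0 : 0 ∉ α ω := fun h => by simpa using hA 0 h
  have h1 : 1 ∉ α ω := fun h => by simpa using hA 1 h
  rw [piHat, Finset.sum_range_succ', Finset.sum_range_succ']
  simp only [h0, h1, zero_add, false_and, if_false, add_zero]
  rw [Finset.mul_sum]
  refine Finset.sum_le_sum fun j hj => ?_
  simp only [add_assoc, Nat.reduceAdd]
  split_ifs with hm
  · obtain ⟨ha, hb⟩ := hm
    have hden := hawkinsY_half_le_denominator hA (hA _ ha)
    have hy := (hawkinsY_mem_Ioc hA (j + 2)).1
    have hy' := (hawkinsY_mem_Ioc hA (k + 3)).1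
    have hle : hawkinsY (α ω) (k + 3) ≤ hawkinsY (α ω) (j + 2) :=
      hawkinsY_antitone hA (by have := Finset.mem_range.1 hj; omega)
    rw [Set.indicator_of_mem (show ω ∈ {ω | j + 2 ∈ α ω} from ha),
      Set.indicator_of_mem (show ω ∈ {ω | j + 4 ∈ α ω} from hb)]
    refine (mul_le_mul (pow_le_pow_left₀ hy'.le hle 3)
      (inv_anti₀ (by positivity) hden) (inv_nonneg.2 (by linarith)) (by positivity)).trans_eq ?_
    field_simp
  · rw [mul_zero]
    have h2 := mem_indicator_mem_Icc (α := α) (j + 2) ω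
    have h3 := mem_indicator_mem_Icc (α := α) (j + 4) ω
    have := mul_nonneg (mul_nonneg (sq_nonneg (hawkinsY (α ω) (j + 2))) h2.1) h3.1
    linarith

theorem piHat_weighted_third_moment {Ω : Type*} [MeasurableSpace Ω] (μ : Measure Ω)
    (α : Ω → Set ℕ) (h : IsHawkinsSieve μ α) :
    (fun n : ℕ => ∫ ω, (hawkinsY (α ω) (n + 1)) ^ 3 * piHat (α ω) n ∂μ)
      =O[atTop] fun n : ℕ => (n : ℝ) / (Mharm n) ^ 4 := by
  obtain ⟨C, N, hC⟩ := exists_sum_one_div_Mharm_pow_le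
  refine IsBigO.of_bound (8192 * C) ?_
  filter_upwards [eventually_ge_atTop (N + 2)] with n hn
  obtain ⟨k, rfl⟩ : ∃ k, n = k + 2 := ⟨n - 2, by omega⟩
  have hk := hC k (by omega)
  have hpos : ∀ ω, 0 ≤ hawkinsY (α ω) (k + 2 + 1) ^ 3 * piHat (α ω) (k + 2) := fun ω =>
    mul_nonneg (pow_nonneg (hawkinsY_mem_Ioc (h.mem_ge_two ω) _).1.le _)
      (piHat_nonneg (h.mem_ge_two ω) _)
  have hM := one_le_Mharm (k + 2)
  rw [Real.norm_of_nonneg (integral_nonneg hpos), Real.norm_of_nonneg (by positivity)]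
  have hint := fun j => (h.integrable_sq_mul_indicators (j + 2)).const_mul 2
  refine (integral_mono_of_nonneg (ae_of_all _ hpos)
    (integrable_finsetSum (Finset.range (k + 1)) fun j _ => hint j)
    (ae_of_all _ fun ω => pow_three_mul_piHat_le (h.mem_ge_two ω) k)).trans ?_
  rw [integral_finsetSum _ fun j _ => hint j]
  calc _ ≤ ∑ j ∈ Finset.range (k + 1), 8192 * (1 / Mharm (j + 2) ^ 4) := by
        refine Finset.sum_le_sum fun j _ => ?_
        rw [integral_const_mul]
        have h1 := h.integral_sq_mul_indicators_le (m := j + 2) (by omega)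
        have h2 := h.integral_hawkinsY_pow_four_le j
        linarith
    _ ≤ _ := by
        rw [← Finset.mul_sum, mul_assoc]
        gcongr
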